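/- Let k be a field of characteristic zero, n ≥ 2, R = k[x_1,…,x_n], and K = Frac(R) its field of rational functions. Let {·,·} : K × K → K be a skew-symmetric biderivation over k (k-bilinear, {a,b} = -{b,a}, and a derivation in each argument) such that {x_i, x_j} is a homogeneous polynomial of degree 2 for all i, j. Assume that the Jacobiator J(a,b,c) = {{a,b},c} + {{b,c},a} + {{c,a},b} vanishes on all degree-zero rational functions, i.e., J(p_1/q_1, p_2/q_2, p_3/q_3) = 0 whenever p_a, q_a ∈ R are homogeneous with deg p_a = deg q_a and q_a ≠ 0. If there exists a nonzero homogeneous polynomial F ∈ R of positive degree d such that {x_i, F} = 0 for every i, then J(f,g,h) = 0 for all f, g, h ∈ K, i.e., {·,·} satisfies the Jacobi identity and is a Poisson bracket. -/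

import Mathlib

open MvPolynomial

/-- A derivation of the field of rational functions is determined by its values on the
variables. -/
theorem Derivation.eq_zero_of_X_eq_zero {k σ K : Type*} [Field k] [Field K] [Algebra k K]
    [Algebra (MvPolynomial σ k) K] [IsScalarTower k (MvPolynomial σ k) K]
    [IsFractionRing (MvPolynomial σ k) K] (D : Derivation k K K)
    (hX : ∀ i, D (algebraMap (MvPolynomial σ k) K (X i)) = 0) : D = 0 := by
  have hpoly : D.compAlgebraMap (MvPolynomial σ k) = 0 :=
    MvPolynomial.derivation_ext fun i => by simpa using hX i
  have hp (p : MvPolynomial σ k) : D (algebraMap (MvPolynomial σ k) K p) = 0 := by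
    simpa using DFunLike.congr_fun hpoly p
  ext a
  obtain ⟨p, q, hq, rfl⟩ := IsFractionRing.div_surjective (A := MvPolynomial σ k) a
  have hq0 : algebraMap (MvPolynomial σ k) K q ≠ 0 :=
    IsFractionRing.to_map_ne_zero_of_mem_nonZeroDivisors hq
  have h := D.leibniz (algebraMap (MvPolynomial σ k) K p / algebraMap (MvPolynomial σ k) K q)
    (algebraMap (MvPolynomial σ k) K q)
  rw [div_mul_cancel₀ _ hq0, hp, hp, smul_zero, zero_add, smul_eq_mul] at h
  simpa [hq0] using h.symm

/-- A derivation of the field of rational functions vanishes if it vanishes on one variable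
and on the quotients of all variables by it. -/
theorem Derivation.eq_zero_of_X_div_X_eq_zero {k σ K : Type*} [Field k] [Field K]
    [Algebra k K] [Algebra (MvPolynomial σ k) K] [IsScalarTower k (MvPolynomial σ k) K]
    [IsFractionRing (MvPolynomial σ k) K] (D : Derivation k K K) (i₀ : σ)
    (h₀ : D (algebraMap (MvPolynomial σ k) K (X i₀)) = 0)
    (hX : ∀ i, D (algebraMap (MvPolynomial σ k) K (X i) /
      algebraMap (MvPolynomial σ k) K (X i₀)) = 0) : D = 0 := by
  have ht : algebraMap (MvPolynomial σ k) K (X i₀) ≠ 0 :=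
    (map_ne_zero_iff _ (IsFractionRing.injective _ K)).2 (X_ne_zero i₀)
  refine D.eq_zero_of_X_eq_zero (σ := σ) fun i => ?_
  rw [← div_mul_cancel₀ (algebraMap (MvPolynomial σ k) K (X i)) ht, D.leibniz, h₀, hX]
  simp

/-- The Jacobiator of a skew-symmetric biderivation, as a derivation in its last argument. -/
theorem exists_derivation_jacobiator {k K : Type*} [Field k] [Field K] [Algebra k K]
    (B : K →ₗ[k] K →ₗ[k] K) (hskew : ∀ a b : K, B a b = - B b a)
    (hleibr : ∀ a b c : K, B a (b * c) = B a b * c + B a c * b)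
    (hleibl : ∀ a b c : K, B (a * b) c = B a c * b + B b c * a) (a b : K) :
    ∃ D : Derivation k K K, ∀ c, D c = B (B a b) c + B (B b c) a + B (B c a) b := by
  refine ⟨Derivation.mk' (B (B a b) + (B.flip a).comp (B b) + (B.flip b).comp (B.flip a))
    fun c c' => ?_, fun c => by simp⟩
  simp only [LinearMap.add_apply, LinearMap.comp_apply, LinearMap.flip_apply, smul_eq_mul,
    hleibr, hleibl, map_add]
  rw [hskew b c, hskew b c']
  simp only [map_neg, LinearMap.neg_apply]
  ring

/-- Lemma 2.1: a homogeneous quadratic skew-symmetric biderivation whose Jacobiator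
vanishes on degree-zero rational functions (i.e. which induces a Poisson bracket on
projective space) and which admits a nonzero homogeneous Casimir polynomial of positive
degree satisfies the Jacobi identity. -/
theorem stmt0 (k : Type*) [Field k] [CharZero k] (n : ℕ) (hn : 2 ≤ n)
    (K : Type*) [Field K] [Algebra k K]
    [Algebra (MvPolynomial (Fin n) k) K]
    [IsScalarTower k (MvPolynomial (Fin n) k) K]
    [IsFractionRing (MvPolynomial (Fin n) k) K]
    (B : K →ₗ[k] K →ₗ[k] K)
    (hskew : ∀ a b : K, B a b = - B b a)
    (hleibr : ∀ a b c : K, B a (b * c) = B a b * c + B a c * b)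
    (hleibl : ∀ a b c : K, B (a * b) c = B a c * b + B b c * a)
    (hquad : ∀ i j : Fin n, ∃ p : MvPolynomial (Fin n) k, p.IsHomogeneous 2 ∧
      B (algebraMap (MvPolynomial (Fin n) k) K (X i))
        (algebraMap (MvPolynomial (Fin n) k) K (X j)) =
        algebraMap (MvPolynomial (Fin n) k) K p)
    (J : K → K → K → K)
    (hJ : ∀ a b c : K, J a b c = B (B a b) c + B (B b c) a + B (B c a) b)
    (hJ0 : ∀ (p₁ q₁ p₂ q₂ p₃ q₃ : MvPolynomial (Fin n) k) (m₁ m₂ m₃ : ℕ),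
      p₁.IsHomogeneous m₁ → q₁.IsHomogeneous m₁ → q₁ ≠ 0 →
      p₂.IsHomogeneous m₂ → q₂.IsHomogeneous m₂ → q₂ ≠ 0 →
      p₃.IsHomogeneous m₃ → q₃.IsHomogeneous m₃ → q₃ ≠ 0 →
      J (algebraMap (MvPolynomial (Fin n) k) K p₁ / algebraMap (MvPolynomial (Fin n) k) K q₁)
        (algebraMap (MvPolynomial (Fin n) k) K p₂ / algebraMap (MvPolynomial (Fin n) k) K q₂)
        (algebraMap (MvPolynomial (Fin n) k) K p₃ / algebraMap (MvPolynomial (Fin n) k) K q₃)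
        = 0)
    (F : MvPolynomial (Fin n) k) (d : ℕ) (hd : 0 < d) (hF : F ≠ 0)
    (hFhom : F.IsHomogeneous d)
    (hFC : ∀ i : Fin n,
      B (algebraMap (MvPolynomial (Fin n) k) K (X i))
        (algebraMap (MvPolynomial (Fin n) k) K F) = 0) :
    ∀ f g h : K, J f g h = 0 := by
  have hder (a b : K) : ∃ D : Derivation k K K, ∀ c, D c = J a b c := by
    simpa only [hJ] using exists_derivation_jacobiator B hskew hleibr hleibl a b
  have hcyc (a b c : K) : J a b c = J b c a := by
    rw [hJ, hJ]; ring
  let i₀ : Fin n := ⟨0, by omega⟩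
  let φ := algebraMap (MvPolynomial (Fin n) k) K
  have hinj : Function.Injective φ := IsFractionRing.injective _ K
  have : CharZero K := charZero_of_injective_algebraMap (algebraMap k K).injective
  have ht : φ (X i₀) ≠ 0 := (map_ne_zero_iff φ hinj).2 (X_ne_zero i₀)
  have hself (a : K) : B a a = 0 := self_eq_neg.1 (hskew a a)
  have hgen (a b : K) (h₀ : J a b (φ (X i₀)) = 0)
      (hX : ∀ i, J a b (φ (X i) / φ (X i₀)) = 0) (c : K) : J a b c = 0 := by
    obtain ⟨D, hD⟩ := hder a b
    rw [← hD, D.eq_zero_of_X_div_X_eq_zero i₀ ((hD _).trans h₀) fun i => (hD _).trans (hX i)]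
    rfl
  have hFcas (a : K) : B a (φ F) = 0 := by
    let D : Derivation k K K := Derivation.mk' (B.flip (φ F)) fun c c' => by
      simp only [LinearMap.flip_apply, hleibl, smul_eq_mul]
      ring
    have hD : D = 0 := D.eq_zero_of_X_eq_zero (σ := Fin n) hFC
    exact DFunLike.congr_fun hD a
  have hJF (a b : K) : J a b (φ F) = 0 := by
    rw [hJ, hFcas, hFcas, hskew (φ F) a, hFcas]
    simp
  have hyyy (i j l : Fin n) :
      J (φ (X i) / φ (X i₀)) (φ (X j) / φ (X i₀)) (φ (X l) / φ (X i₀)) = 0 :=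
    hJ0 _ _ _ _ _ _ 1 1 1 (isHomogeneous_X k i) (isHomogeneous_X k i₀) (X_ne_zero i₀)
      (isHomogeneous_X k j) (isHomogeneous_X k i₀) (X_ne_zero i₀)
      (isHomogeneous_X k l) (isHomogeneous_X k i₀) (X_ne_zero i₀)
  have hyyt (i j : Fin n) : J (φ (X i) / φ (X i₀)) (φ (X j) / φ (X i₀)) (φ (X i₀)) = 0 := by
    have hquot : J (φ (X i) / φ (X i₀)) (φ (X j) / φ (X i₀)) (φ F / φ (X i₀ ^ d)) = 0 :=
      hJ0 _ _ _ _ _ _ 1 1 d (isHomogeneous_X k i) (isHomogeneous_X k i₀) (X_ne_zero i₀)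
        (isHomogeneous_X k j) (isHomogeneous_X k i₀) (X_ne_zero i₀)
        hFhom (isHomogeneous_X_pow i₀ d) (pow_ne_zero _ (X_ne_zero i₀))
    have hF' := hJF (φ (X i) / φ (X i₀)) (φ (X j) / φ (X i₀))
    obtain ⟨D, hD⟩ := hder (φ (X i) / φ (X i₀)) (φ (X j) / φ (X i₀))
    rw [← hD] at hquot hF' ⊢
    rw [map_pow] at hquot
    rw [← div_mul_cancel₀ (φ F) (pow_ne_zero d ht), D.leibniz, hquot, smul_zero, add_zero,
      D.leibniz_pow] at hF'
    have hF0 : φ F ≠ 0 := (map_ne_zero_iff φ hinj).2 hF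
    simpa [hF0, ht, hd.ne'] using hF'
  have htt (a : K) : J (φ (X i₀)) (φ (X i₀)) a = 0 := by
    rw [hJ, hself, hskew a]
    simp
  have hyy (i j : Fin n) (c : K) : J (φ (X i) / φ (X i₀)) (φ (X j) / φ (X i₀)) c = 0 :=
    hgen _ _ (hyyt i j) (hyyy i j) c
  have hty (i : Fin n) (c : K) : J (φ (X i₀)) (φ (X i) / φ (X i₀)) c = 0 :=
    hgen _ _ (by rw [← hcyc, htt]) (fun j => by rw [hcyc, hyy]) c
  have hyt (i : Fin n) (c : K) : J (φ (X i) / φ (X i₀)) (φ (X i₀)) c = 0 :=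
    hgen _ _ (by rw [hcyc, htt]) (fun j => by rw [← hcyc, hyy]) c
  have hcy (c : K) (i : Fin n) (b : K) : J c (φ (X i) / φ (X i₀)) b = 0 :=
    hgen _ _ (by rw [hcyc, hyt]) (fun j => by rw [hcyc, hyy]) b
  have hct (c b : K) : J c (φ (X i₀)) b = 0 :=
    hgen _ _ (by rw [hcyc, htt]) (fun j => by rw [hcyc, hty]) b
  intro f g h
  exact hgen _ _ (by rw [hcyc, hct])
    (fun j => by rw [hcyc, hcy]) h
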